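/- For every n ≥ 3 and every d ≥ 0, the spaces K_n^{(d)} and A_{n−2}^{(e)∘} are finite dimensional and dim K_n^{(d)} = dim A_{n−2}^{(d−1)∘} + Σ_{j=3}^{d} dim A_{n−2}^{(d−j)∘} (i.e. K_n^{(d)} ≅ A_{n−2}^{(d−1)∘} ⊕ A_{n−2}^{(d−3)∘} ⊕ A_{n−2}^{(d−4)∘} ⊕ ⋯). -/

import Mathlib

open Finset

/-- A list `[m_1, …, m_n]` of natural numbers is an Anick chain if it is nonempty,
`m_j ≥ 2` for all `1 ≤ j ≤ n-2`, and (when `n ≥ 2`) either `m_{n-1} ≥ 2` or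
`(m_{n-1}, m_n) = (1, 0)`. -/
def AnickChain (l : List ℕ) : Prop :=
  l ≠ [] ∧ (∀ j, j + 2 < l.length → 2 ≤ l.getD j 0) ∧
    (2 ≤ l.length →
      2 ≤ l.getD (l.length - 2) 0 ∨
        (l.getD (l.length - 2) 0 = 1 ∧ l.getD (l.length - 1) 0 = 0))

/-- The ℚ-vector space with basis the set of all Anick chains (of all lengths);
its length-homogeneous components are the spaces `A_n`. -/
abbrev AnickSpace : Type := {l : List ℕ // AnickChain l} →₀ ℚ

open Classical in
/-- The basis element `[m_1|…|m_n]` attached to a list; by convention it is `0`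
if the list is not an Anick chain. -/
noncomputable def br (l : List ℕ) : AnickSpace :=
  if h : AnickChain l then Finsupp.single ⟨l, h⟩ 1 else 0

/-- The `j`-th entry of a list, `1`-based (with default value 0). -/
def ent (l : List ℕ) (j : ℕ) : ℕ := l.getD (j - 1) 0

/-- Replace the pair of entries at (1-based) positions `j, j+1` by the single entry `c`. -/
def mergeAt (l : List ℕ) (j c : ℕ) : List ℕ := l.take (j - 1) ++ c :: l.drop (j + 1)

/-- Decrease the (1-based) `t`-th entry by one. -/
def decAt (l : List ℕ) (t : ℕ) : List ℕ := l.set (t - 1) (ent l t - 1)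

open Classical in
/-- The value of the Anick differential on the basis chain `[i_1|…|i_{n+1}]`. -/
noncomputable def deltaFun (l : List ℕ) : AnickSpace :=
  let n := l.length - 1
  let i : ℕ → ℚ := fun j => (ent l j : ℚ)
  if 2 ≤ ent l n then
    (∑ j ∈ Icc 1 n, ((-1 : ℚ) ^ j * (i j * (i j - 1) / (i j + i (j + 1) - 1))) •
        br (mergeAt l j (ent l j + ent l (j + 1) - 1)))
    + (∑ j ∈ Icc 2 n, ∑ t ∈ Icc 1 (j - 1),
        ((-1 : ℚ) ^ j * (i t * (i j - 1) * (i (j + 1) - 1) / (i j + i (j + 1) - 1))) •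
          br (mergeAt (decAt l t) j (ent l j + ent l (j + 1))))
    + (∑ j ∈ Icc 2 n, ∑ t ∈ Icc 1 (j - 1),
        ((-1 : ℚ) ^ j * (i j * i (j + 1) * (i t - 1) / (i j + i (j + 1) - 1))) •
          br (mergeAt l j (ent l j + ent l (j + 1) - 1)))
  else if ent l n = 1 ∧ ent l (n + 1) = 0 then
    (∑ j ∈ Icc 1 (n - 2), ((-1 : ℚ) ^ j * (i j * (i j - 1) / (i j + i (j + 1) - 1))) •
        br (mergeAt l j (ent l j + ent l (j + 1) - 1)))
    + (∑ j ∈ Icc 2 (n - 2), ∑ t ∈ Icc 1 (j - 1),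
        ((-1 : ℚ) ^ j * (i t * (i j - 1) * (i (j + 1) - 1) / (i j + i (j + 1) - 1))) •
          br (mergeAt (decAt l t) j (ent l j + ent l (j + 1))))
    + (∑ j ∈ Icc 2 (n - 2), ∑ t ∈ Icc 1 (j - 1),
        ((-1 : ℚ) ^ j * (i j * i (j + 1) * (i t - 1) / (i j + i (j + 1) - 1))) •
          br (mergeAt l j (ent l j + ent l (j + 1) - 1)))
    + (∑ j ∈ Icc 1 (n - 1), ((-1 : ℚ) ^ n * i j) • br ((decAt l j).dropLast))
    + (∑ j ∈ Icc 1 (n - 1), ((-1 : ℚ) ^ (n - 1) * (i j - 1)) • br (l.take (n - 1) ++ [0]))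
    + ((-1 : ℚ) ^ n • br (l.take (n - 1) ++ [0]))
  else 0

/-- The Anick differential `δ` (the direct sum of all the maps `δ_n`; on the
length-one component it vanishes, i.e. `δ_1 = 0`). -/
noncomputable def anickDelta : AnickSpace →ₗ[ℚ] AnickSpace :=
  Finsupp.linearCombination ℚ (fun c => deltaFun c.1)

/-- The value of `∂̃` on a basis chain. -/
noncomputable def dtilFun (l : List ℕ) : AnickSpace :=
  ∑ j ∈ Finset.range l.length, (l.getD j 0 : ℚ) • br (l.set j (l.getD j 0 - 1))

/-- The derivation `∂̃` on the Anick complex. -/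
noncomputable def dtil : AnickSpace →ₗ[ℚ] AnickSpace :=
  Finsupp.linearCombination ℚ (fun c => dtilFun c.1)

/-- `A_n`: the span of the Anick chains of length `n`. -/
noncomputable def A (n : ℕ) : Submodule ℚ AnickSpace :=
  Finsupp.supported ℚ ℚ {c | c.1.length = n}

/-- `A_{n,k}`: the span of the Anick chains of length `n` whose last entry is `≥ k`. -/
noncomputable def Ak (n k : ℕ) : Submodule ℚ AnickSpace :=
  Finsupp.supported ℚ ℚ {c | c.1.length = n ∧ k ≤ c.1.getD (n - 1) 0}

/-- `A_n^{(d)}`: the span of the Anick chains of length `n` and degree `d`. -/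
noncomputable def Adeg (n d : ℕ) : Submodule ℚ AnickSpace :=
  Finsupp.supported ℚ ℚ {c | c.1.length = n ∧ c.1.sum = d}

/-- `A_n^{(d)∘}`: the span of the regular Anick chains (all entries `≥ 2`) of
length `n` and degree `d`. -/
noncomputable def Areg (n d : ℕ) : Submodule ℚ AnickSpace :=
  Finsupp.supported ℚ ℚ {c | c.1.length = n ∧ c.1.sum = d ∧ ∀ j < n, 2 ≤ c.1.getD j 0}

/-- `K_n = ker ∂̃_n ⊆ A_n`. -/
noncomputable def K (n : ℕ) : Submodule ℚ AnickSpace := A n ⊓ LinearMap.ker dtil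

/-- `K_n^{(d)} = K_n ∩ A_n^{(d)}`. -/
noncomputable def Kdeg (n d : ℕ) : Submodule ℚ AnickSpace := K n ⊓ Adeg n d

open Classical in
/-- The component map `a ↦ a_i`: keep only the chains whose last entry is `i`
and delete that last entry. -/
noncomputable def component (i : ℕ) : AnickSpace →ₗ[ℚ] AnickSpace :=
  Finsupp.linearCombination ℚ
    (fun c => if c.1.getLast? = some i then br c.1.dropLast else 0)

/-- The elements `e_1 = [1|0]` and `e_d = Σ_{s=0}^{d-2} (-1)^s C(d,s) [d-s|s]` for `d ≥ 3`. -/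
noncomputable def eElt (d : ℕ) : AnickSpace :=
  if d = 1 then br [1, 0]
  else ∑ s ∈ Finset.range (d - 1), ((-1 : ℚ) ^ s * (d.choose s : ℚ)) • br [d - s, s]

/-- Tuples `(w, a, b)` such that `w ++ [a, b]` is an Anick chain of length `k + 2` and degree `d`. -/
def splitChains (k d : ℕ) : Set (List ℕ × ℕ × ℕ) :=
  {p | p.1.length = k ∧ (∀ x ∈ p.1, 2 ≤ x) ∧ (2 ≤ p.2.1 ∨ (p.2.1 = 1 ∧ p.2.2 = 0)) ∧
    p.1.sum + p.2.1 + p.2.2 = d}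

/-- Lists of length `k` and sum `e` all of whose entries are at least `2`. -/
def regularLists (k e : ℕ) : Set (List ℕ) :=
  {w | w.length = k ∧ (∀ x ∈ w, 2 ≤ x) ∧ w.sum = e}

lemma forall_getD_iff (w : List ℕ) :
    (∀ j < w.length, 2 ≤ w.getD j 0) ↔ ∀ x ∈ w, 2 ≤ x := by
  rw [List.forall_mem_iff_getElem]
  refine forall_congr' fun j => forall_congr' fun h => ?_
  rw [List.getD_eq_getElem _ _ h]

lemma anickChain_append_pair (w : List ℕ) (a b : ℕ) :
    AnickChain (w ++ [a, b]) ↔ (∀ x ∈ w, 2 ≤ x) ∧ (2 ≤ a ∨ (a = 1 ∧ b = 0)) := by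
  rw [← forall_getD_iff]
  simp only [AnickChain, List.length_append, List.length_cons, List.length_nil]
  have ha : (w ++ [a, b]).getD (w.length + (0 + 1 + 1) - 2) 0 = a := by simp
  have hb : (w ++ [a, b]).getD (w.length + (0 + 1 + 1) - 1) 0 = b := by
    simp
  rw [ha, hb]
  refine ⟨fun ⟨_, h1, h2⟩ => ⟨fun j hj => ?_, h2 (by omega)⟩,
    fun ⟨h1, h2⟩ => ⟨by simp, fun j hj => ?_, fun _ => h2⟩⟩
  · have := h1 j (by omega)
    rwa [List.getD_append _ _ _ _ hj] at this
  · have hj' : j < w.length := by omega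
    rw [List.getD_append _ _ _ _ hj']
    exact h1 j hj'

lemma exists_eq_append_pair {l : List ℕ} {k : ℕ} (h : l.length = k + 2) :
    ∃ w a b, w.length = k ∧ l = w ++ [a, b] := by
  obtain ⟨a, b, hab⟩ := List.length_eq_two.1 (show (l.drop k).length = 2 by simp [h])
  exact ⟨l.take k, a, b, by simp [h], by rw [← hab, List.take_append_drop]⟩

lemma anickChain_of_regular {w : List ℕ} (h0 : w ≠ []) (h : ∀ x ∈ w, 2 ≤ x) :
    AnickChain w := by
  rw [← forall_getD_iff] at h
  have := List.length_pos_iff.2 h0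
  exact ⟨h0, fun j hj => h j (by omega), fun _ => Or.inl (h _ (by omega))⟩

lemma finite_length_eq_sum_le (k d : ℕ) : {l : List ℕ | l.length = k ∧ l.sum ≤ d}.Finite := by
  induction k with
  | zero =>
    refine (Set.finite_singleton ([] : List ℕ)).subset fun l hl => ?_
    exact List.length_eq_zero_iff.1 hl.1
  | succ k ih =>
    refine ((Set.finite_Iic d).image2 List.cons ih).subset fun l hl => ?_
    obtain ⟨hl, hs⟩ := hl
    cases l with
    | nil => simp at hl
    | cons x l =>
      simp only [List.length_cons, List.sum_cons] at hl hs
      exact ⟨x, by simp only [Set.mem_Iic]; omega, l, ⟨by omega, by omega⟩, rfl⟩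

lemma finite_regularLists (k e : ℕ) : (regularLists k e).Finite :=
  (finite_length_eq_sum_le k e).subset fun _ h => ⟨h.1, h.2.2.le⟩

lemma finite_splitChains (k d : ℕ) : (splitChains k d).Finite := by
  refine ((finite_length_eq_sum_le k d).prod
    ((Set.finite_Iic d).prod (Set.finite_Iic d))).subset ?_
  rintro ⟨w, a, b⟩ ⟨h1, -, -, h2⟩
  simp only at h1 h2
  simp only [Set.mem_prod, Set.mem_ofPred_eq, Set.mem_Iic]
  omega

lemma finrank_supported_eq_ncard {α : Type*} (s : Set α) :
    Module.finrank ℚ (Finsupp.supported ℚ ℚ s) = s.ncard := by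
  rw [Module.finrank_eq_nat_card_basis (Module.Basis.ofRepr (Finsupp.supportedEquivFinsupp s)),
    Nat.card_coe_set_eq]

lemma finiteDimensional_supported {α : Type*} {s : Set α} (hs : s.Finite) :
    FiniteDimensional ℚ (Finsupp.supported ℚ ℚ s) :=
  have := hs.to_subtype
  Module.Finite.of_basis (Module.Basis.ofRepr (Finsupp.supportedEquivFinsupp s))

lemma injective_append_pair :
    Function.Injective fun p : List ℕ × ℕ × ℕ => p.1 ++ [p.2.1, p.2.2] := by
  rintro ⟨w, a, b⟩ ⟨w', a', b'⟩ h
  obtain ⟨h1, h2⟩ := List.append_inj' h rfl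
  simp_all

lemma image_splitChains (k d : ℕ) :
    (fun p : List ℕ × ℕ × ℕ => p.1 ++ [p.2.1, p.2.2]) '' splitChains k d =
      Subtype.val '' {c : {l // AnickChain l} | c.1.length = k + 2 ∧ c.1.sum = d} := by
  ext l
  constructor
  · rintro ⟨⟨w, a, b⟩, ⟨h1, h2, h3, h4⟩, rfl⟩
    refine ⟨⟨w ++ [a, b], (anickChain_append_pair w a b).2 ⟨h2, h3⟩⟩, ⟨?_, ?_⟩, rfl⟩
    · simpa using h1
    · simpa [add_assoc] using h4
  · rintro ⟨⟨l, hc⟩, ⟨h1, h2⟩, rfl⟩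
    obtain ⟨w, a, b, hw, rfl⟩ := exists_eq_append_pair h1
    obtain ⟨h3, h4⟩ := (anickChain_append_pair w a b).1 hc
    exact ⟨(w, a, b), ⟨hw, h3, h4, by simpa [add_assoc] using h2⟩, rfl⟩

lemma finrank_Adeg (k d : ℕ) : Module.finrank ℚ (Adeg (k + 2) d) = (splitChains k d).ncard := by
  rw [Adeg, finrank_supported_eq_ncard, ← Set.ncard_image_of_injective _ Subtype.val_injective,
    ← image_splitChains, Set.ncard_image_of_injective _ injective_append_pair]

lemma finiteDimensional_Adeg (k d : ℕ) : FiniteDimensional ℚ (Adeg (k + 2) d) := by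
  refine finiteDimensional_supported (Set.Finite.of_finite_image ?_
    Subtype.val_injective.injOn)
  rw [← image_splitChains]
  exact (finite_splitChains k d).image _

lemma image_regular {k : ℕ} (hk : 0 < k) (e : ℕ) :
    Subtype.val '' {c : {l // AnickChain l} |
      c.1.length = k ∧ c.1.sum = e ∧ ∀ j < k, 2 ≤ c.1.getD j 0} = regularLists k e := by
  ext l
  constructor
  · rintro ⟨⟨l, hc⟩, ⟨rfl, h2, h3⟩, rfl⟩
    exact ⟨rfl, (forall_getD_iff l).1 h3, h2⟩
  · rintro ⟨rfl, h2, h3⟩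
    exact ⟨⟨l, anickChain_of_regular (List.length_pos_iff.1 hk) h2⟩,
      ⟨rfl, h3, (forall_getD_iff l).2 h2⟩, rfl⟩

lemma finrank_Areg {k : ℕ} (hk : 0 < k) (e : ℕ) :
    Module.finrank ℚ (Areg k e) = (regularLists k e).ncard := by
  rw [Areg, finrank_supported_eq_ncard, ← Set.ncard_image_of_injective _ Subtype.val_injective,
    image_regular hk]

lemma finiteDimensional_Areg {k : ℕ} (hk : 0 < k) (e : ℕ) : FiniteDimensional ℚ (Areg k e) := by
  refine finiteDimensional_supported (Set.Finite.of_finite_image ?_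
    Subtype.val_injective.injOn)
  rw [image_regular hk]
  exact finite_regularLists k e

lemma br_mem_Adeg (l : List ℕ) : br l ∈ Adeg l.length l.sum := by
  unfold br
  split_ifs with h
  · exact Finsupp.single_mem_supported _ _ ⟨rfl, rfl⟩
  · exact zero_mem _

lemma dtil_br {l : List ℕ} (h : AnickChain l) : dtil (br l) = dtilFun l := by
  simp [dtil, br, h]

lemma sum_set_pred (w : List ℕ) (j : ℕ) (h : 0 < w.getD j 0) :
    (w.set j (w.getD j 0 - 1)).sum + 1 = w.sum := by
  induction w generalizing j with
  | nil => simp at h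
  | cons x w ih =>
    cases j with
    | zero => simp at h ⊢; omega
    | succ j =>
      simp only [List.getD_cons_succ] at h ⊢
      have := ih j h
      simp only [List.set_cons_succ, List.sum_cons]
      omega

lemma dtilFun_mem_Adeg {l : List ℕ} {d : ℕ} (hs : l.sum = d + 1) :
    dtilFun l ∈ Adeg l.length d := by
  refine Submodule.sum_mem _ fun j _ => ?_
  rcases Nat.eq_zero_or_pos (l.getD j 0) with h | h
  · rw [h, Nat.cast_zero, zero_smul]
    exact zero_mem _
  · refine Submodule.smul_mem _ _ ?_
    have h1 := br_mem_Adeg (l.set j (l.getD j 0 - 1))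
    have h2 := sum_set_pred l j h
    rwa [List.length_set, show (l.set j (l.getD j 0 - 1)).sum = d by omega] at h1

lemma dtilFun_append_pair (w : List ℕ) (a b : ℕ) :
    dtilFun (w ++ [a, b]) =
      (∑ j ∈ Finset.range w.length,
        (w.getD j 0 : ℚ) • br (w.set j (w.getD j 0 - 1) ++ [a, b])) +
      (a : ℚ) • br (w ++ [a - 1, b]) + (b : ℚ) • br (w ++ [a, b - 1]) := by
  have hl : (w ++ [a, b]).length = w.length + 1 + 1 := by simp
  rw [dtilFun, hl, Finset.sum_range_succ, Finset.sum_range_succ]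
  congr 1
  · congr 1
    · refine Finset.sum_congr rfl fun j hj => ?_
      rw [Finset.mem_range] at hj
      rw [List.getD_append _ _ _ _ hj, List.set_append_left _ _ hj]
    · simp [List.set_append_right]
  · simp [List.set_append_right]

lemma br_mem_map_dtil (N k d : ℕ) : ∀ (w : List ℕ) (a b : ℕ), w.length = k →
    w.sum + a + b = d → w.sum + b = N → br (w ++ [a, b]) ∈ (Adeg (k + 2) (d + 1)).map dtil := by
  induction N using Nat.strong_induction_on with
  | _ N ih =>
  intro w a b hk hd hN
  by_cases hc : AnickChain (w ++ [a, b])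
  swap
  · simp [br, hc]
  obtain ⟨hw, hab⟩ := (anickChain_append_pair w a b).1 hc
  have hc' : AnickChain (w ++ [a + 1, b]) := (anickChain_append_pair _ _ _).2 ⟨hw, by omega⟩
  have hD : dtilFun (w ++ [a + 1, b]) ∈ (Adeg (k + 2) (d + 1)).map dtil := by
    rw [← dtil_br hc']
    refine Submodule.mem_map_of_mem ?_
    have := br_mem_Adeg (w ++ [a + 1, b])
    rwa [show (w ++ [a + 1, b]).length = k + 2 by simp [hk],
      show (w ++ [a + 1, b]).sum = d + 1 by simp; omega] at this
  have hS : ∑ j ∈ Finset.range w.length,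
      (w.getD j 0 : ℚ) • br (w.set j (w.getD j 0 - 1) ++ [a + 1, b]) ∈
        (Adeg (k + 2) (d + 1)).map dtil := by
    refine Submodule.sum_mem _ fun j _ => ?_
    rcases Nat.eq_zero_or_pos (w.getD j 0) with h | h
    · rw [h, Nat.cast_zero, zero_smul]
      exact zero_mem _
    · have := sum_set_pred w j h
      exact Submodule.smul_mem _ _
        (ih _ (by omega) _ _ _ (by simpa using hk) (by omega) rfl)
  have hB : (b : ℚ) • br (w ++ [a + 1, b - 1]) ∈ (Adeg (k + 2) (d + 1)).map dtil := by
    rcases Nat.eq_zero_or_pos b with h | h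
    · rw [h, Nat.cast_zero, zero_smul]
      exact zero_mem _
    · exact Submodule.smul_mem _ _ (ih _ (by omega) _ _ _ hk (by omega) rfl)
  rw [dtilFun_append_pair, Submodule.add_mem_iff_left _ hB, Submodule.add_mem_iff_right _ hS,
    Nat.add_sub_cancel] at hD
  exact (Submodule.smul_mem_iff _ (by positivity)).1 hD

lemma Adeg_eq_span (n d : ℕ) :
    Adeg n d = Submodule.span ℚ (br '' {l | AnickChain l ∧ l.length = n ∧ l.sum = d}) := by
  rw [Adeg, Finsupp.supported_eq_span_single]
  congr 1
  ext x
  constructor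
  · rintro ⟨⟨l, hc⟩, h, rfl⟩
    exact ⟨l, ⟨hc, h⟩, by simp [br, hc]⟩
  · rintro ⟨l, ⟨hc, h⟩, rfl⟩
    exact ⟨⟨l, hc⟩, h, by simp [br, hc]⟩

lemma map_dtil_Adeg (k d : ℕ) : (Adeg (k + 2) (d + 1)).map dtil = Adeg (k + 2) d := by
  apply le_antisymm
  · rw [Adeg_eq_span, Submodule.map_span, Submodule.span_le]
    rintro _ ⟨_, ⟨l, ⟨hc, hl, hs⟩, rfl⟩, rfl⟩
    rw [dtil_br hc, ← hl]
    exact dtilFun_mem_Adeg hs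
  · rw [Adeg_eq_span _ d, Submodule.span_le]
    rintro _ ⟨l, ⟨-, hl, hs⟩, rfl⟩
    obtain ⟨w, a, b, hw, rfl⟩ := exists_eq_append_pair hl
    exact br_mem_map_dtil _ k d w a b hw (by simpa [add_assoc] using hs) rfl

lemma Kdeg_eq (n d : ℕ) : Kdeg n d = Adeg n d ⊓ LinearMap.ker dtil := by
  have : Adeg n d ≤ A n := Finsupp.supported_mono fun _ h => h.1
  rw [Kdeg, K, inf_right_comm, inf_eq_right.2 this]

lemma finrank_Kdeg_succ (k d : ℕ) :
    Module.finrank ℚ (Adeg (k + 2) d) + Module.finrank ℚ (Kdeg (k + 2) (d + 1)) =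
      Module.finrank ℚ (Adeg (k + 2) (d + 1)) := by
  have := finiteDimensional_Adeg k (d + 1)
  have h := LinearMap.finrank_range_add_finrank_ker (dtil.domRestrict (Adeg (k + 2) (d + 1)))
  rw [LinearMap.range_domRestrict, map_dtil_Adeg, LinearMap.ker_domRestrict] at h
  rw [← h, Kdeg_eq, ← Submodule.map_comap_subtype, Submodule.finrank_map_subtype_eq]

lemma splitChains_succ (k d : ℕ) : splitChains k (d + 1) =
    (fun p => (p.1, p.2.1 + 1, p.2.2)) '' splitChains k d ∪
      ((fun w => (w, 1, 0)) '' regularLists k d ∪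
        ⋃ j ∈ Finset.Icc 3 (d + 1), (fun w => (w, 2, j - 2)) '' regularLists k (d + 1 - j)) := by
  ext ⟨w, a, b⟩
  simp only [splitChains, regularLists, Set.mem_union, Set.mem_image, Set.mem_ofPred_eq,
    Set.mem_iUnion, Prod.exists, Prod.mk.injEq, Finset.mem_Icc]
  constructor
  · rintro ⟨h1, h2, h3, h4⟩
    by_cases ha1 : a = 1
    · exact Or.inr (Or.inl ⟨w, ⟨h1, h2, by omega⟩, rfl, ha1.symm, by omega⟩)
    by_cases hab : a = 2 ∧ b ≠ 0
    · exact Or.inr (Or.inr ⟨b + 2, by omega, w, ⟨h1, h2, by omega⟩, rfl, by omega, by omega⟩)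
    · exact Or.inl ⟨w, a - 1, b, ⟨h1, h2, by omega, by omega⟩, rfl, by omega, rfl⟩
  · rintro (⟨_, a, b, ⟨h1, h2, h3, h4⟩, rfl, rfl, rfl⟩ | ⟨_, ⟨h1, h2, h3⟩, rfl, rfl, rfl⟩ |
      ⟨j, hj, _, ⟨h1, h2, h3⟩, rfl, rfl, rfl⟩)
    · exact ⟨h1, h2, by omega, by omega⟩
    · exact ⟨h1, h2, by omega, by omega⟩
    · exact ⟨h1, h2, by omega, by omega⟩

lemma ncard_biUnion_finset {ι α : Type*} (s : Finset ι) (f : ι → Set α)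
    (hf : ∀ i ∈ s, (f i).Finite) (hd : (s : Set ι).PairwiseDisjoint f) :
    (⋃ i ∈ s, f i).ncard = ∑ i ∈ s, (f i).ncard := by
  classical
  induction s using Finset.induction_on with
  | empty => simp
  | insert i s hi ih =>
    have hfin : (⋃ j ∈ s, f j).Finite :=
      s.finite_toSet.biUnion fun j hj => hf j (Finset.mem_insert_of_mem hj)
    rw [Finset.set_biUnion_insert, Finset.sum_insert hi,
      Set.ncard_union_eq ?_ (hf i (Finset.mem_insert_self i s)) hfin,
      ih (fun j hj => hf j (Finset.mem_insert_of_mem hj)) (hd.subset (by simp))]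
    · refine Set.disjoint_iUnion₂_right.2 fun j hj => hd (by simp) (by simp [hj]) ?_
      rintro rfl
      exact hi hj

lemma ncard_splitChains_succ (k d : ℕ) : (splitChains k (d + 1)).ncard =
    (splitChains k d).ncard + ((regularLists k d).ncard +
      ∑ j ∈ Finset.Icc 3 (d + 1), (regularLists k (d + 1 - j)).ncard) := by
  have hfin : (⋃ j ∈ Finset.Icc 3 (d + 1),
      (fun w : List ℕ => (w, 2, j - 2)) '' regularLists k (d + 1 - j)).Finite :=
    (Finset.finite_toSet _).biUnion fun j _ => (finite_regularLists _ _).image _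
  have hfin' := (finite_regularLists k d).image fun w : List ℕ => (w, 1, 0)
  rw [splitChains_succ, Set.ncard_union_eq ?_ ((finite_splitChains _ _).image _)
      (hfin'.union hfin), Set.ncard_union_eq ?_ hfin' hfin, ncard_biUnion_finset,
    Set.ncard_image_of_injective, Set.ncard_image_of_injective]
  · congr 2
    refine Finset.sum_congr rfl fun j _ => Set.ncard_image_of_injective _ ?_
    intro w w' h
    exact congrArg Prod.fst h
  · intro w w' h
    exact congrArg Prod.fst h
  · rintro ⟨w, a, b⟩ ⟨w', a', b'⟩ h
    simpa using h
  · exact fun j _ => (finite_regularLists _ _).image _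
  · intro i hi j hj hij
    rw [Finset.mem_coe, Finset.mem_Icc] at hi hj
    refine Set.disjoint_left.2 ?_
    rintro _ ⟨w, -, rfl⟩ ⟨w', -, h⟩
    simp only [Prod.mk.injEq, true_and] at h
    omega
  · refine Set.disjoint_left.2 ?_
    rintro _ ⟨w, -, rfl⟩ h
    simp at h
  · refine Set.disjoint_left.2 ?_
    rintro _ ⟨⟨w, a, b⟩, ⟨-, -, h, -⟩, rfl⟩ h'
    simp only at h
    rcases h' with ⟨w', -, h'⟩ | h'
    · simp only [Prod.mk.injEq] at h'
      omega
    · simp only [Set.mem_iUnion, Set.mem_image, Prod.mk.injEq, Finset.mem_Icc] at h'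
      obtain ⟨j, hj, -, -, -, h1, h2⟩ := h'
      omega

/-- for `n ≥ 3` and every `d`, the spaces `K_n^{(d)}` and `A_{n-2}^{(e)∘}`
are finite dimensional and
`dim K_n^{(d)} = dim A_{n-2}^{(d-1)∘} + Σ_{j=3}^{d} dim A_{n-2}^{(d-j)∘}`. -/
theorem dim_Kdeg (n d : ℕ) (hn : 3 ≤ n) :
    FiniteDimensional ℚ (Kdeg n d) ∧ (∀ e : ℕ, FiniteDimensional ℚ (Areg (n - 2) e)) ∧
    Module.finrank ℚ (Kdeg n d) =
      Module.finrank ℚ (Areg (n - 2) (d - 1)) +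
        ∑ j ∈ Finset.Icc 3 d, Module.finrank ℚ (Areg (n - 2) (d - j)) := by
  obtain ⟨k, rfl, hk⟩ : ∃ k, n = k + 2 ∧ 0 < k := ⟨n - 2, by omega, by omega⟩
  rw [Nat.add_sub_cancel]
  have := finiteDimensional_Adeg k d
  have hle : Kdeg (k + 2) d ≤ Adeg (k + 2) d := inf_le_right
  refine ⟨Submodule.finiteDimensional_of_le hle, finiteDimensional_Areg hk, ?_⟩
  simp only [finrank_Areg hk]
  cases d with
  | zero =>
    have h1 : splitChains k 0 = ∅ := by
      refine Set.eq_empty_of_forall_notMem ?_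
      rintro ⟨w, a, b⟩ ⟨-, -, h1, h2⟩
      simp only at h1 h2
      omega
    have h2 : regularLists k 0 = ∅ := by
      refine Set.eq_empty_of_forall_notMem ?_
      rintro (_ | ⟨x, w⟩) ⟨h1, h2, h3⟩
      · simp only [List.length_nil] at h1
        omega
      · have := h2 x (by simp)
        simp only [List.sum_cons] at h3
        omega
    have h3 := Submodule.finrank_mono hle
    rw [finrank_Adeg, h1, Set.ncard_empty] at h3
    simp [h2, Nat.le_zero.1 h3]
  | succ d =>
    have h1 := finrank_Kdeg_succ k d
    rw [finrank_Adeg, finrank_Adeg, ncard_splitChains_succ] at h1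
    exact Nat.add_left_cancel h1
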